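/- arXiv:1701.06686 — 4 statements merged into one kernel-verified Lean document; each statement's English description precedes it below -/
import Mathlib

section
/- In a CADMG 𝒢(V,W), every district D ∈ 𝒟(𝒢) contains at least one fixable vertex, i.e. D ∩ 𝔽(𝒢) ≠ ∅. -/
open scoped Classical
open Finset

namespace Nested

/-- A directed mixed graph: directed (`dir`) and bidirected (`bi`) edges. -/
structure MixedGraph (Vt : Type) where
  dir : Vt → Vt → Prop
  bi : Vt → Vt → Prop

/-- A step along a path: an edge traversed from `src` to `tgt`, with Booleans
recording whether there is an arrowhead at the `src` (resp. `tgt`) end. -/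
structure Step (Vt : Type) where
  src : Vt
  tgt : Vt
  hsrc : Bool
  htgt : Bool

/-- The step corresponds to an actual edge of the mixed graph `M`. -/
def StepIn {Vt : Type} (M : MixedGraph Vt) (s : Step Vt) : Prop :=
  (s.hsrc = false ∧ s.htgt = true ∧ M.dir s.src s.tgt) ∨
  (s.hsrc = true ∧ s.htgt = false ∧ M.dir s.tgt s.src) ∨
  (s.hsrc = true ∧ s.htgt = true ∧ M.bi s.src s.tgt)

/-- `IsWalk M a p b`: `p` is a walk in `M` from `a` to `b`. -/
def IsWalk {Vt : Type} (M : MixedGraph Vt) : Vt → List (Step Vt) → Vt → Prop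
  | a, [], b => a = b
  | a, s :: p, b => s.src = a ∧ StepIn M s ∧ IsWalk M s.tgt p b

/-- The list of vertices visited by a walk starting at `a`. -/
def wverts {Vt : Type} (a : Vt) (p : List (Step Vt)) : List Vt :=
  a :: p.map Step.tgt

/-- The non-endpoint (interior) vertices of a walk. -/
def interiorVerts {Vt : Type} (p : List (Step Vt)) : List Vt :=
  (p.map Step.tgt).dropLast

variable {Vt : Type} [Fintype Vt] [DecidableEq Vt]

/-- `z` is an ancestor (via directed edges) of some element of `C`. -/
def ancOf (M : MixedGraph Vt) (C : Finset Vt) (z : Vt) : Prop :=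
  ∃ c ∈ C, Relation.ReflTransGen M.dir z c

/-- The common vertex of two consecutive steps is a collider. -/
def Collider {Vt : Type} (s t : Step Vt) : Prop := s.htgt = true ∧ t.hsrc = true

/-- The interior vertex shared by consecutive steps `s`, `t` satisfies the
m-connection requirement given `C`: colliders are ancestors of `C`,
non-colliders lie outside `C`. -/
def jointOK (M : MixedGraph Vt) (C : Finset Vt) (s t : Step Vt) : Prop :=
  (Collider s t ∧ ancOf M C s.tgt) ∨ (¬ Collider s t ∧ s.tgt ∉ C)

/-- `a` and `b` are m-connected given `C` in `M`: there is a path (walk with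
distinct vertices) from `a` to `b` every non-collider of which avoids `C` and
every collider of which is an ancestor of `C`. -/
def MConn (M : MixedGraph Vt) (C : Finset Vt) (a b : Vt) : Prop :=
  ∃ p : List (Step Vt), IsWalk M a p b ∧ (wverts a p).Nodup ∧
    List.Chain' (jointOK M C) p

/-- m-separation of the sets `A` and `B` given `C` in `M`. -/
def MSep (M : MixedGraph Vt) (A B C : Finset Vt) : Prop :=
  ∀ a ∈ A, ∀ b ∈ B, ¬ MConn M C a b

/-- There is a directed path from `v` to `w` in `M` all of whose
non-endpoint vertices lie in `L`. -/
def DirVia (M : MixedGraph Vt) (L : Finset Vt) (v w : Vt) : Prop :=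
  ∃ p : List (Step Vt), p ≠ [] ∧ IsWalk M v p w ∧ (wverts v p).Nodup ∧
    (∀ s ∈ p, s.hsrc = false ∧ s.htgt = true) ∧
    (∀ z ∈ interiorVerts p, z ∈ L)

/-- There is a path between `v` and `w` in `M` with arrowheads at both
endpoints, all of whose non-endpoint vertices are non-colliders lying in `L`. -/
def BiVia (M : MixedGraph Vt) (L : Finset Vt) (v w : Vt) : Prop :=
  ∃ p : List (Step Vt), p ≠ [] ∧ IsWalk M v p w ∧ (wverts v p).Nodup ∧
    (∀ s, p.head? = some s → s.hsrc = true) ∧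
    (∀ s, p.getLast? = some s → s.htgt = true) ∧
    (∀ z ∈ interiorVerts p, z ∈ L) ∧
    List.Chain' (fun s t => ¬ Collider s t) p

/-- A (pre-)conditional acyclic directed mixed graph: a mixed graph together
with disjoint finite sets `V` of random and `W` of fixed vertices.  The
well-formedness conditions are collected in `PreCADMG.WF`. -/
structure PreCADMG (Vt : Type) where
  dir : Vt → Vt → Prop
  bi : Vt → Vt → Prop
  V : Finset Vt
  W : Finset Vt

/-- The underlying mixed graph of a CADMG. -/
def PreCADMG.mg {Vt : Type} (G : PreCADMG Vt) : MixedGraph Vt := ⟨G.dir, G.bi⟩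

/-- Well-formedness: `V` and `W` are disjoint, `bi` is symmetric, all edges
join vertices of `V ∪ W`, directed and bidirected edges never point into `W`,
and there are no directed cycles.  (So `WF` with `W = ∅` says: ADMG.) -/
def PreCADMG.WF {Vt : Type} (G : PreCADMG Vt) : Prop :=
  Disjoint G.V G.W ∧
  (∀ a b, G.bi a b → G.bi b a) ∧
  (∀ a b, G.dir a b → a ∈ G.V ∪ G.W ∧ b ∈ G.V) ∧
  (∀ a b, G.bi a b → a ∈ G.V ∧ b ∈ G.V) ∧
  (∀ v, ¬ Relation.TransGen G.dir v v)

/-- The district of `v`: random vertices joined to `v` by a bidirected path. -/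
noncomputable def dis (G : PreCADMG Vt) (v : Vt) : Finset Vt :=
  G.V.filter (fun w => Relation.ReflTransGen G.bi v w)

/-- The set of districts of `G`. -/
noncomputable def districts (G : PreCADMG Vt) : Finset (Finset Vt) :=
  G.V.image (dis G)

/-- Descendants of `v` (including `v` itself, among the vertices of `G`). -/
noncomputable def deF (G : PreCADMG Vt) (v : Vt) : Finset Vt :=
  (G.V ∪ G.W).filter (fun w => Relation.ReflTransGen G.dir v w)

/-- Non-descendants of `v`. -/
noncomputable def ndF (G : PreCADMG Vt) (v : Vt) : Finset Vt :=
  (G.V ∪ G.W) \ deF G v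

/-- Ancestors of the set `D` (including `D`). -/
noncomputable def anS (G : PreCADMG Vt) (D : Finset Vt) : Finset Vt :=
  (G.V ∪ G.W).filter (fun a => ∃ d ∈ D, Relation.ReflTransGen G.dir a d)

/-- Parents of the set `D`. -/
noncomputable def paS (G : PreCADMG Vt) (D : Finset Vt) : Finset Vt :=
  (G.V ∪ G.W).filter (fun a => ∃ d ∈ D, G.dir a d)

/-- Markov blanket: `mb(t) = pa(dis(t)) ∪ (dis(t) \ {t})`. -/
noncomputable def mb (G : PreCADMG Vt) (t : Vt) : Finset Vt :=
  paS G (dis G t) ∪ (dis G t).erase t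

/-- `v` is fixable in `G`: `v` is random and `dis(v) ∩ de(v) = {v}`. -/
def fixable (G : PreCADMG Vt) (v : Vt) : Prop :=
  v ∈ G.V ∧ dis G v ∩ deF G v = {v}

/-- The set `𝔽(G)` of fixable vertices. -/
noncomputable def FixF (G : PreCADMG Vt) : Finset Vt :=
  G.V.filter (fun v => fixable G v)

/-- The graph `φ_r(G)`:  `r` becomes fixed and edges with an arrowhead at `r`
are deleted. -/
def fixG (G : PreCADMG Vt) (r : Vt) : PreCADMG Vt where
  dir a b := G.dir a b ∧ b ≠ r
  bi a b := G.bi a b ∧ a ≠ r ∧ b ≠ r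
  V := G.V.erase r
  W := insert r G.W

/-- The induced subgraph on `A`, preserving random/fixed status. -/
def induce (G : PreCADMG Vt) (A : Finset Vt) : PreCADMG Vt where
  dir a b := G.dir a b ∧ a ∈ A ∧ b ∈ A
  bi a b := G.bi a b ∧ a ∈ A ∧ b ∈ A
  V := G.V ∩ A
  W := G.W ∩ A

/-- `A` is an ancestral set in `G`. -/
def Ancestral (G : PreCADMG Vt) (A : Finset Vt) : Prop :=
  A ⊆ G.V ∪ G.W ∧
  ∀ a ∈ A, ∀ b ∈ G.V ∪ G.W, Relation.ReflTransGen G.dir b a → b ∈ A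

/-- `ord` is (the rank function of) a topological total ordering for `G`:
if `a ≺ b` then `a` is not a descendant of `b`. -/
def IsTopo (G : PreCADMG Vt) (ord : Vt → ℕ) : Prop :=
  Function.Injective ord ∧
  ∀ a b, ord a < ord b → ¬ Relation.ReflTransGen G.dir b a

/-- The predecessors of `d` in the ordering `ord`. -/
noncomputable def preF (G : PreCADMG Vt) (ord : Vt → ℕ) (d : Vt) : Finset Vt :=
  (G.V ∪ G.W).filter (fun a => ord a < ord d)

/-- The graph `G^{|W}`: all pairs of fixed vertices joined by bidirected
edges. -/
def augMG (G : PreCADMG Vt) : MixedGraph Vt :=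
  ⟨G.dir, fun a b => G.bi a b ∨ (a ∈ G.W ∧ b ∈ G.W ∧ a ≠ b)⟩

/-- Adjacency in the augmented graph `(G)^a`: joined in `G^{|W}` by a path on
which every non-endpoint vertex is a collider. -/
def augEdge (G : PreCADMG Vt) (a b : Vt) : Prop :=
  a ≠ b ∧ ∃ p : List (Step Vt), p ≠ [] ∧ IsWalk (augMG G) a p b ∧
    (wverts a p).Nodup ∧ List.Chain' Collider p

/-- Undirected separation of `a` from `b` by `C` (w.r.t. adjacency `E`). -/
def USepPt (E : Vt → Vt → Prop) (C : Finset Vt) (a b : Vt) : Prop :=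
  ∀ l : List Vt, l.Chain' E → l.head? = some a → l.getLast? = some b →
    l.Nodup → ∃ v ∈ l, v ∈ C

/-- Undirected separation of `A` from `B` by `C`. -/
def USep (E : Vt → Vt → Prop) (C A B : Finset Vt) : Prop :=
  ∀ a ∈ A, ∀ b ∈ B, USepPt E C a b

/-- The latent projection of `G` obtained by projecting out the (random)
vertices in `H`. -/
def project (G : PreCADMG Vt) (H : Finset Vt) : PreCADMG Vt where
  dir v w := v ∈ (G.V \ H) ∪ G.W ∧ w ∈ G.V \ H ∧ v ≠ w ∧ DirVia G.mg H v w
  bi v w := v ∈ G.V \ H ∧ w ∈ G.V \ H ∧ v ≠ w ∧ BiVia G.mg H v w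
  V := G.V \ H
  W := G.W

/-! ## Kernels -/

variable {𝔛 : Vt → Type} [∀ v, Fintype (𝔛 v)]

/-- Sum a function of a joint state over all assignments to the coordinates in
`S`, the remaining coordinates being given by `x`. -/
noncomputable def sumOver (S : Finset Vt) (f : (∀ v, 𝔛 v) → ℝ) (x : ∀ v, 𝔛 v) : ℝ :=
  ∑ y : ((v : {v : Vt // v ∈ S}) → 𝔛 v.1),
    f (fun v => if h : v ∈ S then y ⟨v, h⟩ else x v)

/-- `f` depends only on the coordinates in `S`. -/
def DepOn (f : (∀ v, 𝔛 v) → ℝ) (S : Finset Vt) : Prop :=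
  ∀ x y : ∀ v, 𝔛 v, (∀ v ∈ S, x v = y v) → f x = f y

/-- `q` is a kernel `q_V(x_V | x_W)`: a nonnegative function of `(x_V, x_W)`
with `∑_{x_V} q_V(x_V | x_W) = 1` for every `x_W`. -/
def IsKernel (V W : Finset Vt) (q : (∀ v, 𝔛 v) → ℝ) : Prop :=
  (∀ x, 0 ≤ q x) ∧ DepOn q (V ∪ W) ∧ ∀ x, sumOver V q x = 1

/-- Case (a) of the definition of kernel conditional independence
`X_A ⫫ X_B | X_C [q_V]`:  `A ∩ W = ∅` and the conditional kernel
`q_V(x_A | x_B, x_C, x_{W∖(B∪C)})` is, wherever defined, a function of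
`x_A, x_C` only. -/
def KIndepA (V W : Finset Vt) (q : (∀ v, 𝔛 v) → ℝ) (A B C : Finset Vt) : Prop :=
  A ∩ W = ∅ ∧
  ∀ x y : ∀ v, 𝔛 v, (∀ v ∈ A ∪ C, x v = y v) →
    0 < sumOver (V \ (B ∪ C)) q x → 0 < sumOver (V \ (B ∪ C)) q y →
    sumOver (V \ (A ∪ B ∪ C)) q x / sumOver (V \ (B ∪ C)) q x =
      sumOver (V \ (A ∪ B ∪ C)) q y / sumOver (V \ (B ∪ C)) q y

/-- Kernel conditional independence `X_A ⫫ X_B | X_C [q_V]`. -/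
def KIndep (V W : Finset Vt) (q : (∀ v, 𝔛 v) → ℝ) (A B C : Finset Vt) : Prop :=
  KIndepA V W q A B C ∨ KIndepA V W q B A C

/-- The conditional kernel `q_V(x_d | x_T)` (as a function of the joint
state). -/
noncomputable def condOn (V : Finset Vt) (q : (∀ v, 𝔛 v) → ℝ) (d : Vt)
    (T : Finset Vt) : (∀ v, 𝔛 v) → ℝ :=
  fun x => sumOver (V \ insert d T) q x / sumOver (V \ T) q x

/-- The kernel `q*_{V∖H} = q_V / q_V(x_H | x_T, x_W)` obtained by fixing `H`. -/
noncomputable def qstar (V H T : Finset Vt) (q : (∀ v, 𝔛 v) → ℝ) :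
    (∀ v, 𝔛 v) → ℝ :=
  fun x => q x / (sumOver (V \ (H ∪ T)) q x / sumOver (V \ T) q x)

/-- The kernel fixing operation `φ_r(q; G) = q / q_V(x_r | x_{mb_G(r)})`. -/
noncomputable def fixK (G : PreCADMG Vt) (r : Vt) (q : (∀ v, 𝔛 v) → ℝ) :
    (∀ v, 𝔛 v) → ℝ :=
  fun x => q x / condOn G.V q r (mb G r) x

/-- The global Markov property for a CADMG (`q ∈ 𝒫^c_m(G)`). -/
def Pcm (G : PreCADMG Vt) (q : (∀ v, 𝔛 v) → ℝ) : Prop :=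
  ∀ A B C : Finset Vt, A ⊆ G.V ∪ G.W → B ⊆ G.V ∪ G.W → C ⊆ G.V ∪ G.W →
    Disjoint A B → Disjoint A C → Disjoint B C →
    MSep (augMG G) A B C → KIndep G.V G.W q A B C

/-- The augmented Markov property for a CADMG (`q ∈ 𝒫^c_a(G)`). -/
def Pca (G : PreCADMG Vt) (q : (∀ v, 𝔛 v) → ℝ) : Prop :=
  ∀ A B C : Finset Vt, A ⊆ G.V ∪ G.W → B ⊆ G.V ∪ G.W → C ⊆ G.V ∪ G.W →
    Disjoint A B → Disjoint A C → Disjoint B C →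
    USep (augEdge (induce G (anS G (A ∪ B ∪ C)))) C A B →
    KIndep G.V G.W q A B C

/-- The local Markov property for `G` at `t`. -/
def LocalAt (G : PreCADMG Vt) (q : (∀ v, 𝔛 v) → ℝ) (t : Vt) : Prop :=
  KIndep G.V G.W q {t} ((G.V ∪ G.W) \ insert t (mb G t)) (mb G t)

/-- The ordered local Markov property for a CADMG (`q ∈ 𝒫^c_l(G, ≺)`). -/
def Pcl (G : PreCADMG Vt) (ord : Vt → ℕ) (q : (∀ v, 𝔛 v) → ℝ) : Prop :=
  ∀ A : Finset Vt, Ancestral G A → ∀ m ∈ A, (∀ a ∈ A, ord a ≤ ord m) →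
    m ∈ G.V →
    LocalAt (induce G ((G.V ∩ A) ∪ G.W)) (sumOver (G.V \ A) q) m

/-- Tian factorization for a CADMG (`q ∈ 𝒫^c_f(G)`). -/
def Pcf (G : PreCADMG Vt) (q : (∀ v, 𝔛 v) → ℝ) : Prop :=
  ∀ A : Finset Vt, Ancestral G A →
    ∃ f : Finset Vt → ((∀ v, 𝔛 v) → ℝ),
      (∀ D ∈ districts (induce G A), IsKernel D (paS G D \ D) (f D)) ∧
      ∀ x, sumOver (G.V \ A) q x = ∏ D ∈ districts (induce G A), f D x

/-- `T^{(d,D)}_≺ = mb_G(d, an_G(D) ∩ pre_≺(d))`. -/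
noncomputable def Tset (G : PreCADMG Vt) (ord : Vt → ℕ) (d : Vt)
    (D : Finset Vt) : Finset Vt :=
  mb (induce G (insert d (anS G D ∩ preF G ord d))) d

/-- The district kernel
`q_D(x_D | x_{pa(D)∖D}) = ∏_{d ∈ D} q_V(x_d | x_{T^{(d,D)}_≺})`. -/
noncomputable def qD (G : PreCADMG Vt) (ord : Vt → ℕ)
    (q : (∀ v, 𝔛 v) → ℝ) (D : Finset Vt) : (∀ v, 𝔛 v) → ℝ :=
  fun x => ∏ d ∈ D, condOn G.V q d (Tset G ord d D) x

/-! ## Fixing sequences and nested Markov properties -/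

/-- Iterated graph fixing. -/
def fixGs : PreCADMG Vt → List Vt → PreCADMG Vt
  | G, [] => G
  | G, r :: rs => fixGs (fixG G r) rs

/-- Iterated kernel fixing. -/
noncomputable def fixKs : PreCADMG Vt → ((∀ v, 𝔛 v) → ℝ) → List Vt →
    ((∀ v, 𝔛 v) → ℝ)
  | _, q, [] => q
  | G, q, r :: rs => fixKs (fixG G r) (fixK G r q) rs

/-- A valid fixing sequence: each vertex is fixable when its turn comes. -/
def ValidSeq : PreCADMG Vt → List Vt → Prop
  | _, [] => True
  | G, r :: rs => fixable G r ∧ ValidSeq (fixG G r) rs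

/-- The global nested Markov property for an ADMG. -/
def NestedGlobal (G : PreCADMG Vt) (p : (∀ v, 𝔛 v) → ℝ) : Prop :=
  ∀ ws : List Vt, ValidSeq G ws → Pcm (fixGs G ws) (fixKs G p ws)

/-- `C` is intrinsic in `G`: a district of a reachable CADMG. -/
def Intrinsic (G : PreCADMG Vt) (C : Finset Vt) : Prop :=
  ∃ ws : List Vt, ws.Nodup ∧ ValidSeq G ws ∧ C ∈ districts (fixGs G ws)

/-- The ordered local nested Markov property for an ADMG. -/
def NestedLocal (G : PreCADMG Vt) (ord : Vt → ℕ) (p : (∀ v, 𝔛 v) → ℝ) : Prop :=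
  ∀ C : Finset Vt, Intrinsic G C →
    ∀ ws : List Vt, ws.Nodup → ValidSeq G ws → ws.toFinset = G.V \ C →
      ∀ m ∈ C, (∀ c ∈ C, ord c ≤ ord m) →
        LocalAt (fixGs G ws) (fixKs G p ws) m

end Nested

namespace Nested

/-- A nonempty set of vertices of a finite acyclic relation has a member with no other
member of the set among its descendants. -/
theorem exists_mem_forall_reflTransGen_eq {α : Type*} [Finite α] {r : α → α → Prop}
    (hr : ∀ v, ¬ Relation.TransGen r v v) {s : Set α} (hs : s.Nonempty) :
    ∃ m ∈ s, ∀ w ∈ s, Relation.ReflTransGen r m w → w = m := by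
  let R : α → α → Prop := fun a b => Relation.TransGen r b a
  have : IsTrans α R := ⟨fun _ _ _ hab hbc => hbc.trans hab⟩
  have : Std.Irrefl R := ⟨hr⟩
  obtain ⟨m, hm, hmin⟩ := (Finite.wellFounded_of_trans_of_irrefl R).has_min s hs
  refine ⟨m, hm, fun w hw h => ?_⟩
  rcases Relation.reflTransGen_iff_eq_or_transGen.mp h with h | h
  · exact h
  · exact absurd h (hmin w hw)

/-- If bidirected edges are symmetric, every member of a district generates the same district. -/
theorem dis_eq_of_mem {Vt : Type} [Fintype Vt] [DecidableEq Vt] {G : PreCADMG Vt}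
    (hG : ∀ a b, G.bi a b → G.bi b a) {v w : Vt} (hw : w ∈ dis G v) : dis G w = dis G v := by
  have hvw : Relation.ReflTransGen G.bi v w := (mem_filter.mp hw).2
  have : Std.Symm G.bi := ⟨hG⟩
  have hwv : Relation.ReflTransGen G.bi w v := symm hvw
  exact filter_congr fun u _ => ⟨hvw.trans, hwv.trans⟩

end Nested

open Nested in
/-- in a CADMG `𝒢(V,W)`, every district `D ∈ 𝒟(𝒢)` contains at
least one fixable vertex: `D ∩ 𝔽(𝒢) ≠ ∅`. -/
theorem district_contains_fixable
    {Vt : Type} [Fintype Vt] [DecidableEq Vt]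
    (G : PreCADMG Vt) (hWF : G.WF) :
    ∀ D ∈ districts G, D ∩ FixF G ≠ ∅ := by
  intro D hD
  obtain ⟨v, hv, rfl⟩ := mem_image.mp hD
  obtain ⟨-, hsymm, -, -, hacyc⟩ := hWF
  obtain ⟨m, hm, hmax⟩ := exists_mem_forall_reflTransGen_eq hacyc
    (s := {w | w ∈ dis G v}) ⟨v, mem_filter.mpr ⟨hv, .refl⟩⟩
  have hmV : m ∈ G.V := (mem_filter.mp hm).1
  refine Finset.Nonempty.ne_empty ⟨m, mem_inter.mpr ⟨hm, mem_filter.mpr ⟨hmV, hmV, ?_⟩⟩⟩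
  rw [dis_eq_of_mem hsymm hm]
  refine eq_singleton_iff_unique_mem.mpr ⟨mem_inter.mpr ⟨hm, ?_⟩, fun w hw => ?_⟩
  · exact mem_filter.mpr ⟨mem_union_left _ hmV, .refl⟩
  · exact hmax w (mem_inter.mp hw).1 (mem_filter.mp (mem_inter.mp hw).2).2
end

section
/- If 𝒢(V,W) is a CADMG, q_V(x_V | x_W) is a kernel, and r ∈ 𝔽(𝒢), then for all x_r ∈ 𝔛_r and x_W ∈ 𝔛_W for which it is defined, Σ_{x_{V∖{r}}} φ_r(q_V(x_V | x_W); 𝒢) = 1; that is, φ_r(q_V; 𝒢) is a kernel over X_{V∖{r}} indexed by x_{W∪{r}}. -/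
open scoped Classical
open Finset

namespace Nested

theorem sumOver_union {Vt : Type} [DecidableEq Vt] {𝔛 : Vt → Type} [∀ v, Fintype (𝔛 v)]
    {S T : Finset Vt} (hST : Disjoint S T) (f : (∀ v, 𝔛 v) → ℝ) (x : ∀ v, 𝔛 v) :
    sumOver (S ∪ T) f x = sumOver S (sumOver T f) x := by
  unfold sumOver
  rw [← (Equiv.piFinsetUnion 𝔛 hST).sum_comp, Fintype.sum_prod_type]
  refine Finset.sum_congr rfl fun y _ => Finset.sum_congr rfl fun z _ => congrArg f ?_
  funext v
  by_cases hT : v ∈ T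
  · have hU : v ∈ S ∪ T := Finset.mem_union_right _ hT
    simp only [hT, hU, dif_pos]
    exact Equiv.piFinsetUnion_right 𝔛 hST hT hU
  · by_cases hS : v ∈ S
    · have hU : v ∈ S ∪ T := Finset.mem_union_left _ hS
      simp only [hT, hU, hS, dif_pos, dif_neg, not_false_eq_true]
      exact Equiv.piFinsetUnion_left 𝔛 hST hS hU
    · simp [hT, hS]

theorem sumOver_eq_of_eqOn_compl {Vt : Type} [DecidableEq Vt] {𝔛 : Vt → Type}
    [∀ v, Fintype (𝔛 v)] {S : Finset Vt} (f : (∀ v, 𝔛 v) → ℝ) {x y : ∀ v, 𝔛 v}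
    (h : ∀ v ∉ S, x v = y v) : sumOver S f x = sumOver S f y := by
  refine Finset.sum_congr rfl fun z _ => congrArg f ?_
  funext v
  split_ifs with hv
  · rfl
  · exact h v hv

theorem sumOver_congr {Vt : Type} [DecidableEq Vt] {𝔛 : Vt → Type} [∀ v, Fintype (𝔛 v)]
    {S : Finset Vt} {f g : (∀ v, 𝔛 v) → ℝ} {x : ∀ v, 𝔛 v}
    (h : ∀ y, (∀ v ∉ S, y v = x v) → f y = g y) : sumOver S f x = sumOver S g x :=
  Finset.sum_congr rfl fun _ _ => h _ fun _ hv => dif_neg hv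

theorem sumOver_div {Vt : Type} [DecidableEq Vt] {𝔛 : Vt → Type} [∀ v, Fintype (𝔛 v)]
    {S : Finset Vt} {f g : (∀ v, 𝔛 v) → ℝ} {x : ∀ v, 𝔛 v}
    (hg : ∀ y, (∀ v ∉ S, y v = x v) → g y = g x) :
    sumOver S (fun y => f y / g y) x = sumOver S f x / g x := by
  rw [sumOver_congr (g := fun y => f y / g x) fun y hy => by rw [hg y hy]]
  exact (Finset.sum_div _ _ _).symm

theorem notMem_mb_of_fixable {Vt : Type} [DecidableEq Vt]
    {G : PreCADMG Vt} (hWF : G.WF) {r : Vt} (hr : fixable G r) : r ∉ mb G r := by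
  obtain ⟨-, -, hdir, -, hacyc⟩ := hWF
  simp only [mb, paS, Finset.mem_union, Finset.mem_filter, Finset.mem_erase, ne_eq,
    not_true_eq_false, false_and, or_false]
  rintro ⟨-, d, hd, hrd⟩
  have hmem : d ∈ dis G r ∩ deF G r :=
    Finset.mem_inter.2 ⟨hd, Finset.mem_filter.2
      ⟨Finset.mem_union_left _ (hdir r d hrd).2, Relation.ReflTransGen.single hrd⟩⟩
  rw [hr.2, Finset.mem_singleton] at hmem
  subst hmem
  exact hacyc d (Relation.TransGen.single hrd)

/-- Dividing a kernel by `q_V(x_r | x_T)` and summing out `V ∖ {r}` gives `1`, for any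
conditioning set `T` avoiding `r`. -/
theorem sumOver_erase_div_condOn {Vt : Type} [DecidableEq Vt] {𝔛 : Vt → Type}
    [∀ v, Fintype (𝔛 v)] {V T : Finset Vt} {r : Vt} (hrT : r ∉ T)
    (q : (∀ v, 𝔛 v) → ℝ) (x : ∀ v, 𝔛 v) (hq : sumOver V q x = 1)
    (hpos : ∀ y : ∀ v, 𝔛 v, (∀ v ∉ V ∩ T, y v = x v) →
      sumOver (V \ insert r T) q y ≠ 0) :
    sumOver (V.erase r) (fun y => q y / condOn V q r T y) x = 1 := by
  have hsplit : V.erase r = (V ∩ T) ∪ (V \ insert r T) := by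
    grind
  have hsplit' : V = (V ∩ T) ∪ (V \ T) := by grind
  have hdisj : Disjoint (V ∩ T) (V \ insert r T) := by
    rw [Finset.disjoint_left]; grind
  have hdisj' : Disjoint (V ∩ T) (V \ T) := by
    rw [Finset.disjoint_left]; grind
  rw [hsplit, sumOver_union hdisj, ← hq]
  conv_rhs => rw [hsplit', sumOver_union hdisj']
  refine sumOver_congr fun y hy => ?_
  rw [sumOver_div]
  · rw [condOn, div_div_cancel₀ (hpos y hy)]
  · intro z hz
    rw [condOn, condOn, sumOver_eq_of_eqOn_compl q hz,
      sumOver_eq_of_eqOn_compl (S := V \ T) q fun v hv => hz v ?_]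
    grind

end Nested

open Nested in
/-- if `r ∈ 𝔽(𝒢)`, then for all `x_r` and `x_W` for which it is
defined (i.e. whenever the divisor `q_V(x_r | x_{mb(r)})` is positive for all
joint states compatible with those values),
`Σ_{x_{V∖{r}}} φ_r(q_V; 𝒢) = 1`; so `φ_r(q_V; 𝒢)` is a kernel over
`X_{V∖{r}}` indexed by `x_{W∪{r}}`. -/
theorem fixed_kernel_is_kernel
    {Vt : Type} [Fintype Vt] [DecidableEq Vt]
    {𝔛 : Vt → Type} [∀ v, Fintype (𝔛 v)]
    (G : PreCADMG Vt) (hWF : G.WF)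
    (q : (∀ v, 𝔛 v) → ℝ) (hq : IsKernel G.V G.W q)
    (r : Vt) (hr : fixable G r) (x : ∀ v, 𝔛 v)
    (hdef : ∀ y : ∀ v, 𝔛 v, (∀ v ∈ insert r G.W, y v = x v) →
      0 < sumOver (G.V \ insert r (mb G r)) q y) :
    sumOver (G.V.erase r) (fixK G r q) x = 1 := by
  refine sumOver_erase_div_condOn (notMem_mb_of_fixable hWF hr) q x (hq.2.2 x)
    fun y hy => (hdef y fun v hv => hy v ?_).ne'
  rcases Finset.mem_insert.1 hv with rfl | hv
  · exact fun h => notMem_mb_of_fixable hWF hr (Finset.mem_inter.1 h).2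
  · exact fun h => Finset.disjoint_left.1 hWF.1 (Finset.mem_inter.1 h).1 hv
end

section
/- If r ∈ 𝔽(𝒢) for a CADMG 𝒢, then 𝔽(𝒢) ∖ {r} ⊆ 𝔽(φ_r(𝒢)); i.e., every vertex other than r that was fixable before fixing r remains fixable afterwards. -/
open scoped Classical
open Finset

open Nested in
/-- if `r ∈ 𝔽(𝒢)` for a CADMG `𝒢`, then
`𝔽(𝒢) ∖ {r} ⊆ 𝔽(φ_r(𝒢))`. -/
theorem fixable_no_backtracking
    {Vt : Type} [Fintype Vt] [DecidableEq Vt]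
    (G : PreCADMG Vt) (hWF : G.WF) (r : Vt) (hr : fixable G r) :
    FixF G \ {r} ⊆ FixF (fixG G r) := by
  have mono_bi : ∀ a b, Relation.ReflTransGen (fixG G r).bi a b → Relation.ReflTransGen G.bi a b :=
    fun a b h => Relation.ReflTransGen.mono (fun _ _ e => And.left e) a b h
  have mono_dir : ∀ a b, Relation.ReflTransGen (fixG G r).dir a b →
      Relation.ReflTransGen G.dir a b :=
    fun a b h => Relation.ReflTransGen.mono (fun _ _ e => And.left e) a b h
  intro v hv
  simp only [FixF, Finset.mem_sdiff, Finset.mem_filter, Finset.mem_singleton] at hv ⊢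
  obtain ⟨⟨hvV, -, hfix⟩, hvr⟩ := hv
  have hvV' : v ∈ (fixG G r).V := Finset.mem_erase.2 ⟨hvr, hvV⟩
  refine ⟨hvV', hvV', Finset.Subset.antisymm ?_ ?_⟩
  · rw [← hfix]
    intro w hw
    simp only [dis, deF, Finset.mem_inter, Finset.mem_filter, Finset.mem_union] at hw ⊢
    have hwV : w ∈ G.V := (Finset.mem_erase.1 hw.1.1).2
    exact ⟨⟨hwV, mono_bi _ _ hw.1.2⟩, Or.inl hwV, mono_dir _ _ hw.2.2⟩
  · intro w hw
    rw [Finset.mem_singleton] at hw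
    subst hw
    simp only [dis, deF, Finset.mem_inter, Finset.mem_filter, Finset.mem_union]
    exact ⟨⟨hvV', .refl⟩, Or.inl hvV', .refl⟩
end

section
/- Let 𝒢 be a CADMG, r ∈ 𝔽(𝒢), and let D^r ∈ 𝒟(𝒢) be the district containing r. Then 𝒟(φ_r(𝒢)) = (𝒟(𝒢) ∖ {D^r}) ∪̇ 𝒟(𝒢_{D^r∖{r}}). Consequently, every D ∈ 𝒟(φ_r(𝒢)) satisfies D ⊆ D* for some D* ∈ 𝒟(𝒢), and if D ≠ D* then r ∈ D*. -/
open scoped Classical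
open Finset

namespace Nested

theorem mem_dis {Vt : Type} {G : PreCADMG Vt} {v w : Vt} :
    w ∈ dis G v ↔ w ∈ G.V ∧ Relation.ReflTransGen G.bi v w := by
  simp [dis]

theorem mem_districts {Vt : Type} [Fintype Vt] [DecidableEq Vt] {G : PreCADMG Vt}
    {D : Finset Vt} : D ∈ districts G ↔ ∃ v ∈ G.V, dis G v = D := by
  simp [districts]

theorem PreCADMG.WF.reach_symm {Vt : Type} {G : PreCADMG Vt} (h : G.WF) {a b : Vt}
    (hab : Relation.ReflTransGen G.bi a b) : Relation.ReflTransGen G.bi b a :=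
  have : Std.Symm G.bi := ⟨h.2.1⟩
  Relation.ReflTransGen.stdSymm.symm _ _ hab

theorem PreCADMG.WF.dis_eq_of_reach {Vt : Type} {G : PreCADMG Vt} (h : G.WF) {a b : Vt}
    (hab : Relation.ReflTransGen G.bi a b) : dis G a = dis G b := by
  ext w
  simp only [mem_dis]
  exact and_congr_right fun _ => ⟨(h.reach_symm hab).trans, hab.trans⟩

theorem reach_of_reach_fixG {Vt : Type} [Fintype Vt] [DecidableEq Vt] {G : PreCADMG Vt}
    {r v w : Vt} (h : Relation.ReflTransGen (fixG G r).bi v w) :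
    Relation.ReflTransGen G.bi v w :=
  Relation.ReflTransGen.mono (fun _ _ e => e.1) _ _ h

/-- Districts not containing `r` are unchanged by fixing `r`. -/
theorem dis_fixG_of_not_reach {Vt : Type} [Fintype Vt] [DecidableEq Vt] {G : PreCADMG Vt}
    (h : G.WF) {r v : Vt} (hv : ¬ Relation.ReflTransGen G.bi r v) :
    dis (fixG G r) v = dis G v := by
  have hne {w : Vt} (hw : Relation.ReflTransGen G.bi v w) : w ≠ r := by
    rintro rfl
    exact hv (h.reach_symm hw)
  ext w
  rw [mem_dis, mem_dis]
  constructor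
  · rintro ⟨hw, hvw⟩
    exact ⟨Finset.mem_of_mem_erase hw, reach_of_reach_fixG hvw⟩
  · rintro ⟨hw, hvw⟩
    refine ⟨Finset.mem_erase.2 ⟨hne hvw, hw⟩, ?_⟩
    clear hw
    induction hvw with
    | refl => exact .refl
    | tail hab e ih => exact ih.tail ⟨e, hne hab, hne (hab.tail e)⟩

/-- Within the district of `r`, fixing `r` has the same districts as deleting `r`. -/
theorem dis_fixG_of_reach {Vt : Type} [Fintype Vt] [DecidableEq Vt] {G : PreCADMG Vt}
    (h : G.WF) {r v : Vt} (hv : Relation.ReflTransGen G.bi r v) :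
    dis (fixG G r) v = dis (induce G ((dis G r).erase r)) v := by
  ext w
  rw [mem_dis, mem_dis]
  constructor
  · rintro ⟨hw, hvw⟩
    obtain ⟨hwr, hwV⟩ := Finset.mem_erase.1 hw
    refine ⟨Finset.mem_inter.2 ⟨hwV, Finset.mem_erase.2 ⟨hwr, mem_dis.2
      ⟨hwV, hv.trans (reach_of_reach_fixG hvw)⟩⟩⟩, ?_⟩
    clear hw hwr hwV
    induction hvw with
    | refl => exact .refl
    | tail hab e ih =>
      have hra := hv.trans (reach_of_reach_fixG hab)
      obtain ⟨haV, hbV⟩ := h.2.2.2.1 _ _ e.1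
      exact ih.tail ⟨e.1, Finset.mem_erase.2 ⟨e.2.1, mem_dis.2 ⟨haV, hra⟩⟩,
        Finset.mem_erase.2 ⟨e.2.2, mem_dis.2 ⟨hbV, hra.tail e.1⟩⟩⟩
  · rintro ⟨hw, hvw⟩
    obtain ⟨hwV, hwA⟩ := Finset.mem_inter.1 hw
    exact ⟨Finset.mem_erase.2 ⟨Finset.ne_of_mem_erase hwA, hwV⟩,
      Relation.ReflTransGen.mono (fun _ _ e =>
        ⟨e.1, Finset.ne_of_mem_erase e.2.1, Finset.ne_of_mem_erase e.2.2⟩) _ _ hvw⟩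

end Nested

open Nested in
/-- for `r ∈ 𝔽(𝒢)` with district `D^r`,
`𝒟(φ_r(𝒢)) = (𝒟(𝒢) ∖ {D^r}) ∪̇ 𝒟(𝒢_{D^r∖{r}})`; consequently every
`D ∈ 𝒟(φ_r(𝒢))` satisfies `D ⊆ D*` for some `D* ∈ 𝒟(𝒢)`, and if
`D ≠ D*` then `r ∈ D*`. -/
theorem districts_after_fixing
    {Vt : Type} [Fintype Vt] [DecidableEq Vt]
    (G : PreCADMG Vt) (hWF : G.WF) (r : Vt) (hr : fixable G r) :
    (districts (fixG G r)
        = (districts G).erase (dis G r)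
            ∪ districts (induce G ((dis G r).erase r))) ∧
    Disjoint ((districts G).erase (dis G r))
      (districts (induce G ((dis G r).erase r))) ∧
    (∀ D ∈ districts (fixG G r), ∃ Dstar ∈ districts G,
        D ⊆ Dstar ∧ (D ≠ Dstar → r ∈ Dstar)) := by
  refine ⟨?_, ?_, ?_⟩
  · ext D
    simp only [Finset.mem_union, Finset.mem_erase, mem_districts]
    constructor
    · rintro ⟨v, hv, rfl⟩
      obtain ⟨hvr, hvV⟩ := Finset.mem_erase.1 hv
      by_cases hrv : Relation.ReflTransGen G.bi r v
      · exact .inr ⟨v, Finset.mem_inter.2 ⟨hvV, Finset.mem_erase.2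
          ⟨hvr, mem_dis.2 ⟨hvV, hrv⟩⟩⟩, (dis_fixG_of_reach hWF hrv).symm⟩
      · rw [dis_fixG_of_not_reach hWF hrv]
        refine .inl ⟨fun heq => hrv ?_, v, hvV, rfl⟩
        exact (mem_dis.1 (heq ▸ mem_dis.2 ⟨hvV, .refl⟩ : v ∈ dis G r)).2
    · rintro (⟨hne, v, hvV, rfl⟩ | ⟨v, hv, rfl⟩)
      · have hrv : ¬ Relation.ReflTransGen G.bi r v :=
          fun hrv => hne (hWF.dis_eq_of_reach hrv).symm
        refine ⟨v, Finset.mem_erase.2 ⟨?_, hvV⟩, dis_fixG_of_not_reach hWF hrv⟩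
        rintro rfl
        exact hrv .refl
      · obtain ⟨hvV, hvA⟩ := Finset.mem_inter.1 hv
        obtain ⟨hvr, hvD⟩ := Finset.mem_erase.1 hvA
        exact ⟨v, Finset.mem_erase.2 ⟨hvr, hvV⟩, dis_fixG_of_reach hWF (mem_dis.1 hvD).2⟩
  · rw [Finset.disjoint_left]
    intro D hD hD'
    obtain ⟨hne, hD⟩ := Finset.mem_erase.1 hD
    obtain ⟨v, -, rfl⟩ := mem_districts.1 hD
    obtain ⟨u, hu, heq⟩ := mem_districts.1 hD'
    have hvu : u ∈ dis G v := heq ▸ mem_dis.2 ⟨hu, .refl⟩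
    have hru := Finset.mem_of_mem_erase (Finset.mem_inter.1 hu).2
    exact hne ((hWF.dis_eq_of_reach (mem_dis.1 hvu).2).trans
      (hWF.dis_eq_of_reach (mem_dis.1 hru).2).symm)
  · intro D hD
    obtain ⟨v, hv, rfl⟩ := mem_districts.1 hD
    refine ⟨dis G v, mem_districts.2 ⟨v, Finset.mem_of_mem_erase hv, rfl⟩, ?_, ?_⟩
    · intro w hw
      obtain ⟨hwV, hvw⟩ := mem_dis.1 hw
      exact mem_dis.2 ⟨Finset.mem_of_mem_erase hwV, reach_of_reach_fixG hvw⟩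
    · intro hne
      by_contra hr'
      exact hne (dis_fixG_of_not_reach hWF
        fun hrv => hr' (mem_dis.2 ⟨hr.1, hWF.reach_symm hrv⟩))
end
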